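/- For all integers i ≥ 0 and r ≥ 0, ∑_{k=0}^{r} (-1)^k · C(2r−2k, i−k) · C(r,k) · Catalan(k) = C(r, ⌊i/2⌋) · C(r, ⌊(i+1)/2⌋). -/

import Mathlib

open Finset

/-- Catalan number as a rational: `(1/(k+1)) C(2k,k)`. -/
def cat (k : ℕ) : ℚ := ((2 * k).choose k : ℚ) / (k + 1)

open Polynomial in
lemma aux_lin (r m : ℕ) (a : ℚ[X]) :
    ((1 + C a * X : ℚ[X][X]) ^ r).coeff m = a ^ m * (r.choose m : ℚ[X]) := by
  have h : (1 + C a * X : ℚ[X][X]) ^ r = ((1 + X) ^ r : ℚ[X][X]).comp (C a * X) := by simp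
  rw [h, comp_C_mul_X_coeff, coeff_one_add_X_pow, mul_comm]

open Polynomial in
lemma aux_cat (k : ℕ) :
    ((1 - X) * (1 + X) ^ (2 * k) : ℚ[X][X]).coeff k = C (cat k) := by
  rw [sub_mul, one_mul, coeff_sub, coeff_one_add_X_pow]
  cases k with
  | zero => simp [cat]
  | succ n =>
    rw [coeff_X_mul, coeff_one_add_X_pow]
    have h := Nat.choose_succ_right_eq (2 * (n + 1)) n
    have h2 : 2 * (n + 1) - n = n + 2 := by omega
    rw [h2] at h
    have hq : ((2 * (n + 1)).choose (n + 1) : ℚ) * (n + 1) = (2 * (n + 1)).choose n * (n + 2) := by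
      exact_mod_cast h
    have e : cat (n + 1) = ((2 * (n + 1)).choose (n + 1) : ℚ) - (2 * (n + 1)).choose n := by
      unfold cat
      have : (n : ℚ) + 1 + 1 ≠ 0 := by positivity
      push_cast
      rw [div_eq_iff this]
      linarith
    rw [e]
    simp

open Polynomial in
lemma aux_left (r : ℕ) :
    ((1 - X) * ((1 + C (-X) * X) * (X + C (-X))) ^ r : ℚ[X][X]).coeff r =
      ∑ k ∈ Finset.range (r + 1),
        C ((-1) ^ k * (r.choose k : ℚ) * cat k) * (X ^ k * (1 + X) ^ (2 * r - 2 * k)) := by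
  have h : ((1 + C (-X) * X) * (X + C (-X)) : ℚ[X][X]) =
      C (-X) * (1 + X) ^ 2 + C ((1 + X) ^ 2) * X := by
    simp only [map_neg, map_pow, map_add, map_one]
    ring
  rw [h, add_pow, Finset.mul_sum, finsetSum_coeff]
  refine Finset.sum_congr rfl fun k hk => ?_
  have hk' : k ≤ r := by simpa [Nat.lt_succ_iff] using hk
  have e : ((1 - X) * ((C (-X) * (1 + X) ^ 2) ^ k * (C ((1 + X) ^ 2) * X) ^ (r - k) *
      (r.choose k : ℚ[X][X])) : ℚ[X][X]) =
      C ((-X) ^ k * ((1 + X) ^ 2) ^ (r - k) * (r.choose k : ℚ[X])) *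
        (((1 - X) * (1 + X) ^ (2 * k)) * X ^ (r - k)) := by
    simp only [map_mul, map_pow, map_natCast, mul_pow, pow_mul]
    ring
  rw [e, coeff_C_mul, coeff_mul_X_pow', if_pos (Nat.sub_le _ _), Nat.sub_sub_self hk', aux_cat,
    ← pow_mul, Nat.mul_sub]
  simp only [map_mul, map_pow, map_natCast, map_neg, map_one]
  rw [neg_pow]
  ring

open Polynomial in
lemma aux_right (r : ℕ) :
    ((1 - X) * ((1 + C (-X) * X) * (X + C (-X))) ^ r : ℚ[X][X]).coeff r =
      ∑ j ∈ Finset.range (r + 1), C ((r.choose j : ℚ) * r.choose j) * X ^ (2 * j) +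
      ∑ j ∈ Finset.range r, C ((r.choose j : ℚ) * r.choose (j + 1)) * X ^ (2 * j + 1) := by
  have key : ∀ m ≤ r, ((1 + C (-X) * X) ^ r * (X + C (-X)) ^ r : ℚ[X][X]).coeff m =
      ∑ j ∈ Finset.range (m + 1), C ((r.choose j : ℚ) * r.choose (r - m + j)) *
        (-X) ^ (r - m + 2 * j) := by
    intro m hm
    rw [coeff_mul, Finset.Nat.sum_antidiagonal_eq_sum_range_succ_mk]
    refine Finset.sum_congr rfl fun j hj => ?_
    have hj' : j ≤ m := by simpa [Nat.lt_succ_iff] using hj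
    simp only
    rw [aux_lin, coeff_X_add_C_pow]
    have h1 : r - (m - j) = r - m + j := by omega
    have h2 : r.choose (m - j) = r.choose (r - m + j) := by
      rw [← h1, Nat.choose_symm (by omega)]
    rw [h1, h2]
    simp only [map_mul, map_natCast]
    ring
  rw [mul_pow, sub_mul, one_mul, coeff_sub, key r le_rfl]
  have p1 : ∀ j, (-X : ℚ[X]) ^ (2 * j) = X ^ (2 * j) := fun j => by
    rw [pow_mul, neg_sq, pow_mul]
  rw [sub_eq_add_neg]
  congr 1
  · simp [p1]
  · cases r with
    | zero => simp
    | succ n =>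
      rw [coeff_X_mul, key n (by omega), ← Finset.sum_neg_distrib]
      refine Finset.sum_congr rfl fun j hj => ?_
      have : n + 1 - n = 1 := by omega
      rw [this, pow_add, p1, add_comm 1 j]
      ring

open Polynomial in
theorem aux_main (i r : ℕ) :
    ∑ k ∈ Finset.range (r + 1),
        (-1 : ℚ) ^ k * (if k ≤ i then ((2 * r - 2 * k).choose (i - k) : ℚ) else 0) *
          (r.choose k : ℚ) * cat k =
      (r.choose (i / 2) : ℚ) * (r.choose ((i + 1) / 2) : ℚ) := by
  have h := congrArg (fun p : ℚ[X] => p.coeff i) ((aux_left r).symm.trans (aux_right r))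
  simp only [finsetSum_coeff, coeff_add, coeff_C_mul, coeff_X_pow_mul', coeff_one_add_X_pow,
    coeff_X_pow] at h
  refine Eq.trans (Finset.sum_congr rfl fun k _ => ?_) (h.trans ?_)
  · ring
  · rcases Nat.even_or_odd' i with ⟨c, rfl | rfl⟩
    · have a1 : 2 * c / 2 = c := by omega
      have a2 : (2 * c + 1) / 2 = c := by omega
      have b : ∀ j, 2 * c ≠ 2 * j + 1 := by omega
      have b2 : ∀ j, (2 * c = 2 * j) = (c = j) := fun j => by simp
      simp only [a1, a2, b, b2, if_false, mul_zero, Finset.sum_const_zero, add_zero, mul_ite,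
        mul_one, Finset.sum_ite_eq, Finset.mem_range]
      split_ifs with hc
      · rfl
      · rw [Nat.choose_eq_zero_of_lt (by omega)]; simp
    · have a1 : (2 * c + 1) / 2 = c := by omega
      have a2 : (2 * c + 1 + 1) / 2 = c + 1 := by omega
      have b : ∀ j, 2 * c + 1 ≠ 2 * j := by omega
      have b2 : ∀ j, (2 * c + 1 = 2 * j + 1) = (c = j) := fun j => by simp
      simp only [a1, a2, b, b2, if_false, mul_zero, Finset.sum_const_zero, zero_add, mul_ite,
        mul_one, Finset.sum_ite_eq, Finset.mem_range]
      split_ifs with hc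
      · rfl
      · rw [Nat.choose_eq_zero_of_lt (show r < c + 1 by omega)]; simp

theorem lemma_A3 (i r : ℕ) :
    ∑ k ∈ Finset.range (r + 1),
        (-1 : ℚ) ^ k * (if k ≤ i then ((2 * r - 2 * k).choose (i - k) : ℚ) else 0) *
          (r.choose k : ℚ) * cat k =
      (r.choose (i / 2) : ℚ) * (r.choose ((i + 1) / 2) : ℚ) := by
  exact aux_main i r
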